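/- arXiv:1908.11554 — 4 statements merged into one kernel-verified Lean document; each statement's English description precedes it below -/
import Mathlib

section
/- Let G = (V,E) be a finite simple graph with |V| = n ≥ 1 and |E| = m ≥ 1, and let G′ be the associated ASHG on agent set V ∪ {s₁,s₂,s₃}. If for some integer k with 0 ≤ k ≤ m there is a partition of the agents of G′ with social welfare at least 2(3mn − m + k), then there is a partition (V₁,V₂,V₃) of V such that at least k edges of G have their endpoints in two different sets. -/
def IsPartitionFun {A : Type*} [Fintype A] [DecidableEq A] (P : A → Finset A) : Prop :=
  (∀ a, a ∈ P a) ∧ ∀ a b, b ∈ P a → P b = P a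

def util {A : Type*} [Fintype A] [DecidableEq A] (w : A → A → ℚ) (P : A → Finset A) (a : A) : ℚ :=
  ∑ b ∈ (P a).erase a, w a b

def welfare {A : Type*} [Fintype A] [DecidableEq A] (w : A → A → ℚ) (P : A → Finset A) : ℚ :=
  ∑ a, util w P a

/-- The weights of the ASHG `G′` associated to a finite simple graph `G` with
`n = |V|`, `m = |E|`: agents are `V ⊕ Fin 3` (the `Fin 3` part being the super
vertices `s₁, s₂, s₃`), `w(sᵢ, v) = 3m`, `w(sᵢ, sⱼ) = −6mn` for `i ≠ j`,
`w(x, y) = −1` for every edge `{x,y}` of `G`, and all other weights `0`. -/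
def gw {V : Type*} [Fintype V] [DecidableEq V] (G : SimpleGraph V) [DecidableRel G.Adj] :
    V ⊕ Fin 3 → V ⊕ Fin 3 → ℚ := fun x y =>
  match x, y with
  | Sum.inl a, Sum.inl b => if G.Adj a b then -1 else 0
  | Sum.inl _, Sum.inr _ => 3 * (G.edgeFinset.card : ℚ)
  | Sum.inr _, Sum.inl _ => 3 * (G.edgeFinset.card : ℚ)
  | Sum.inr i, Sum.inr j =>
      if i = j then 0 else -6 * (G.edgeFinset.card : ℚ) * (Fintype.card V : ℚ)

/-- The number of edges of `G` whose endpoints lie in two different sets of the partition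
of `V` given by `c : V → Fin 3`. -/
noncomputable def crossCount {V : Type*} [Fintype V] [DecidableEq V]
    (G : SimpleGraph V) [DecidableRel G.Adj] (c : V → Fin 3) : ℕ :=
  (@Finset.filter _ (fun e => ∃ x y : V, e = s(x, y) ∧ c x ≠ c y) (Classical.decPred _)
    G.edgeFinset).card

theorem IsPartitionFun.mem_comm {A : Type*} [Fintype A] [DecidableEq A] {P : A → Finset A}
    (hP : IsPartitionFun P) (a b : A) : a ∈ P b ↔ b ∈ P a :=
  ⟨fun h => hP.2 b a h ▸ hP.1 b, fun h => hP.2 a b h ▸ hP.1 a⟩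

theorem IsPartitionFun.mem_trans {A : Type*} [Fintype A] [DecidableEq A] {P : A → Finset A}
    (hP : IsPartitionFun P) {a b c : A} (hab : b ∈ P a) (hbc : c ∈ P b) : c ∈ P a :=
  hP.2 a b hab ▸ hbc

theorem welfare_eq_sum_ite {A : Type*} [Fintype A] [DecidableEq A] {w : A → A → ℚ}
    (hw : ∀ a, w a a = 0) (P : A → Finset A) :
    welfare w P = ∑ a, ∑ b, if b ∈ P a then w a b else 0 := by
  refine Finset.sum_congr rfl fun a _ => ?_
  rw [util, Finset.sum_erase _ (hw a), ← Finset.sum_filter]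
  simp

/-- The number of super vertices in the coalition of the vertex `v`. -/
def superCount {V : Type*} [Fintype V] [DecidableEq V]
    (P : V ⊕ Fin 3 → Finset (V ⊕ Fin 3)) (v : V) : ℚ :=
  ∑ i, if Sum.inr i ∈ P (Sum.inl v) then 1 else 0

/-- The number of ordered pairs of distinct super vertices sharing a coalition. -/
def superPairs {V : Type*} [Fintype V] [DecidableEq V]
    (P : V ⊕ Fin 3 → Finset (V ⊕ Fin 3)) : ℕ :=
  ∑ i : Fin 3, ∑ j : Fin 3, if Sum.inr j ∈ P (Sum.inr i) ∧ i ≠ j then 1 else 0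

/-- The number of ordered pairs of adjacent vertices sharing a coalition. -/
def innerPairs {V : Type*} [Fintype V] [DecidableEq V] (G : SimpleGraph V) [DecidableRel G.Adj]
    (P : V ⊕ Fin 3 → Finset (V ⊕ Fin 3)) : ℚ :=
  ∑ a, ∑ b, if Sum.inl b ∈ P (Sum.inl a) ∧ G.Adj a b then 1 else 0

theorem sum_ite_adj {V : Type*} [Fintype V] (G : SimpleGraph V) [DecidableRel G.Adj] :
    (∑ a, ∑ b, if G.Adj a b then (1 : ℚ) else 0) = 2 * (G.edgeFinset.card : ℚ) := by
  have h : (2 : ℚ) * G.edgeFinset.card = ((2 * G.edgeFinset.card : ℕ) : ℚ) := by push_cast; rfl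
  rw [h, ← G.sum_degrees_eq_twice_card_edges, Nat.cast_sum]
  refine Finset.sum_congr rfl fun a _ => ?_
  rw [Finset.sum_boole, ← G.card_neighborFinset_eq_degree, G.neighborFinset_eq_filter]

section

variable {V : Type*} [Fintype V] [DecidableEq V] (G : SimpleGraph V) [DecidableRel G.Adj]
  {P : V ⊕ Fin 3 → Finset (V ⊕ Fin 3)}

theorem welfare_gw (hP : IsPartitionFun P) :
    welfare (gw G) P = 6 * (G.edgeFinset.card : ℚ) * ∑ v, superCount P v
      - 6 * (G.edgeFinset.card : ℚ) * (Fintype.card V : ℚ) * superPairs P - innerPairs G P := by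
  have hdiag : ∀ a, gw G a a = 0 := by rintro (a | i) <;> simp [gw]
  have hVV : (∑ a, ∑ b, if Sum.inl b ∈ P (Sum.inl a) then gw G (Sum.inl a) (Sum.inl b) else 0)
      = - innerPairs G P := by
    simp only [innerPairs, ← Finset.sum_neg_distrib]
    refine Finset.sum_congr rfl fun a _ => Finset.sum_congr rfl fun b _ => ?_
    by_cases h : Sum.inl b ∈ P (Sum.inl a) <;> by_cases h' : G.Adj a b <;> simp [gw, h, h']
  have hVS : (∑ a, ∑ i, if Sum.inr i ∈ P (Sum.inl a) then gw G (Sum.inl a) (Sum.inr i) else 0)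
      = 3 * (G.edgeFinset.card : ℚ) * ∑ v, superCount P v := by
    simp only [superCount, Finset.mul_sum, mul_ite, mul_one, mul_zero, gw]
  have hSV : (∑ i, ∑ a, if Sum.inl a ∈ P (Sum.inr i) then gw G (Sum.inr i) (Sum.inl a) else 0)
      = 3 * (G.edgeFinset.card : ℚ) * ∑ v, superCount P v := by
    rw [Finset.sum_comm, ← hVS]
    refine Finset.sum_congr rfl fun a _ => Finset.sum_congr rfl fun i _ => ?_
    simp only [hP.mem_comm (Sum.inl a) (Sum.inr i), gw]
  have hSS : (∑ i, ∑ j, if Sum.inr j ∈ P (Sum.inr i) then gw G (Sum.inr i) (Sum.inr j) else 0)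
      = -(6 * (G.edgeFinset.card : ℚ) * (Fintype.card V : ℚ) * superPairs P) := by
    simp only [superPairs, Nat.cast_sum, Finset.mul_sum, ← Finset.sum_neg_distrib]
    refine Finset.sum_congr rfl fun i _ => Finset.sum_congr rfl fun j _ => ?_
    by_cases h : Sum.inr j ∈ P (Sum.inr i) <;> by_cases h' : i = j <;> simp [gw, h, h']
  rw [welfare_eq_sum_ite hdiag]
  simp only [Fintype.sum_sum_type, Finset.sum_add_distrib]
  rw [hVV, hVS, hSV, hSS]
  ring

theorem superCount_le (hP : IsPartitionFun P) (v : V) :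
    superCount P v ≤ 1 + (superPairs P : ℚ) / 2 := by
  have key : ∀ i j : Fin 3, Sum.inr i ∈ P (Sum.inl v) → Sum.inr j ∈ P (Sum.inl v) →
      Sum.inr j ∈ P (Sum.inr i) := fun i j hi hj =>
    hP.mem_trans ((hP.mem_comm _ _).1 hi) hj
  have hle : ∑ i : Fin 3, ∑ j : Fin 3,
      (if (Sum.inr i ∈ P (Sum.inl v) ∧ Sum.inr j ∈ P (Sum.inl v)) ∧ i ≠ j then 1 else 0)
      ≤ superPairs P := by
    refine Finset.sum_le_sum fun i _ => Finset.sum_le_sum fun j _ => ?_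
    split_ifs with h h'
    · exact le_rfl
    · exact absurd ⟨key i j h.1.1 h.1.2, h.2⟩ h'
    · exact Nat.zero_le _
    · exact le_rfl
  have hle' := (Nat.cast_le (α := ℚ)).2 hle
  have hnonneg : (0 : ℚ) ≤ superPairs P := Nat.cast_nonneg _
  simp only [superCount, Fin.sum_univ_three, Nat.cast_add, Nat.cast_ite] at hle' ⊢
  generalize (superPairs P : ℚ) = s at hle' hnonneg ⊢
  by_cases h0 : Sum.inr 0 ∈ P (Sum.inl v) <;> by_cases h1 : Sum.inr 1 ∈ P (Sum.inl v) <;>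
    by_cases h2 : Sum.inr 2 ∈ P (Sum.inl v) <;> simp [h0, h1, h2] at hle' ⊢ <;> linarith

theorem innerPairs_nonneg : 0 ≤ innerPairs G P :=
  Finset.sum_nonneg fun _ _ => Finset.sum_nonneg fun _ _ => by split_ifs <;> norm_num

theorem two_mul_crossCount (c : V → Fin 3) :
    (∑ a, ∑ b, if G.Adj a b ∧ c a ≠ c b then (1 : ℚ) else 0) = 2 * (crossCount G c : ℚ) := by
  let H : SimpleGraph V :=
    { Adj := fun a b => G.Adj a b ∧ c a ≠ c b
      symm := ⟨fun _ _ h => ⟨h.1.symm, h.2.symm⟩⟩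
      loopless := ⟨fun _ h => h.2 rfl⟩ }
  let : DecidableRel H.Adj := fun a b => inferInstanceAs (Decidable (G.Adj a b ∧ c a ≠ c b))
  have hH : crossCount G c = H.edgeFinset.card := by
    unfold crossCount
    congr 1
    ext e
    induction e with | _ x y => ?_
    simp only [Finset.mem_filter, SimpleGraph.mem_edgeFinset, SimpleGraph.mem_edgeSet]
    refine and_congr_right fun _ => ⟨?_, fun h => ⟨x, y, rfl, h⟩⟩
    rintro ⟨u, v, he, h⟩
    rcases Sym2.eq_iff.1 he with ⟨rfl, rfl⟩ | ⟨rfl, rfl⟩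
    exacts [h, h.symm]
  rw [hH, ← sum_ite_adj H]

/-- If vertices of equal colour share a coalition, the edges that are not cut lie inside
coalitions. -/
theorem two_mul_card_edgeFinset_le {c : V → Fin 3}
    (hc : ∀ a b, c a = c b → Sum.inl b ∈ P (Sum.inl a)) :
    2 * (G.edgeFinset.card : ℚ) ≤ 2 * (crossCount G c : ℚ) + innerPairs G P := by
  rw [← sum_ite_adj, ← two_mul_crossCount, innerPairs, ← Finset.sum_add_distrib]
  refine Finset.sum_le_sum fun a _ => ?_
  rw [← Finset.sum_add_distrib]
  refine Finset.sum_le_sum fun b _ => ?_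
  by_cases hab : G.Adj a b <;> by_cases h : c a = c b <;> simp [hab, h]
  · simp [hc a b h]
  · split_ifs <;> norm_num

end

/-- if `n ≥ 1`, `m ≥ 1`, `0 ≤ k ≤ m`, and some partition of the agents of `G′`
has social welfare at least `2(3mn − m + k)`, then there is a partition `(V₁,V₂,V₃)` of `V`
such that at least `k` edges of `G` have their endpoints in two different sets. -/
theorem exists_three_cut_of_welfare {V : Type*} [Fintype V] [DecidableEq V]
    (G : SimpleGraph V) [DecidableRel G.Adj]
    (hn : 1 ≤ Fintype.card V) (hm : 1 ≤ G.edgeFinset.card)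
    (k : ℕ) (hk : k ≤ G.edgeFinset.card)
    (P : V ⊕ Fin 3 → Finset (V ⊕ Fin 3)) (hP : IsPartitionFun P)
    (hw : 2 * (3 * (G.edgeFinset.card : ℚ) * (Fintype.card V : ℚ)
        - (G.edgeFinset.card : ℚ) + (k : ℚ)) ≤ welfare (gw G) P) :
    ∃ c : V → Fin 3, k ≤ crossCount G c := by
  rw [welfare_gw G hP] at hw
  have hI := innerPairs_nonneg G (P := P)
  have hn' : (1 : ℚ) ≤ Fintype.card V := by exact_mod_cast hn
  have hm' : (1 : ℚ) ≤ G.edgeFinset.card := by exact_mod_cast hm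
  have hk' : (0 : ℚ) ≤ k := Nat.cast_nonneg k
  have hsum : ∑ v, superCount P v ≤ (Fintype.card V : ℚ) * (1 + (superPairs P : ℚ) / 2) := by
    refine (Finset.sum_le_sum fun v _ => superCount_le hP v).trans_eq ?_
    simp [mul_add]
  set m : ℚ := (G.edgeFinset.card : ℚ)
  set n : ℚ := (Fintype.card V : ℚ)
  have hmn : m ≤ m * n := le_mul_of_one_le_right (by linarith) hn'
  have hpairs : (superPairs P : ℚ) = 0 := by
    by_contra hne
    have hmsum := mul_le_mul_of_nonneg_left hsum (by linarith : 0 ≤ m)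
    have h1 : (1 : ℚ) ≤ superPairs P := by
      exact_mod_cast Nat.one_le_iff_ne_zero.2 (by exact_mod_cast hne)
    have h2 := mul_le_mul_of_nonneg_left h1 (by linarith : 0 ≤ m * n)
    nlinarith
  have hle1 : ∀ v, superCount P v ≤ 1 := fun v => by
    simpa [hpairs] using superCount_le hP v
  have hex : ∀ v, ∃ i, Sum.inr i ∈ P (Sum.inl v) := by
    by_contra! hcon
    obtain ⟨v, hv⟩ := hcon
    have hv0 : superCount P v = 0 := by simp [superCount, hv]
    have hlt : ∑ u, superCount P u ≤ n - 1 := by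
      rw [← Finset.add_sum_erase _ _ (Finset.mem_univ v), hv0, zero_add]
      refine (Finset.sum_le_sum fun u _ => hle1 u).trans_eq ?_
      simp [Finset.card_erase_of_mem, Nat.cast_sub hn, n]
    have := mul_le_mul_of_nonneg_left hlt (by linarith : 0 ≤ m)
    rw [hpairs] at hw
    linarith
  choose c hc using hex
  refine ⟨c, ?_⟩
  have hcut := two_mul_card_edgeFinset_le G (P := P) (c := c) fun a b hab =>
    hP.mem_trans (hc a) (hab ▸ (hP.mem_comm _ _).1 (hc b))
  have hms := mul_le_mul_of_nonneg_left hsum (by linarith : 0 ≤ m)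
  rw [hpairs] at hw hms
  have : (k : ℚ) ≤ crossCount G c := by linarith
  exact_mod_cast this
end

section
/- Let a₁,…,aₙ be positive integers with W = Σᵢ aᵢ and aᵢ < W/2 for every i, and let H″ be the associated ASHG. If S ⊆ {1,…,n} satisfies Σ_{i∈S} aᵢ = W/2, then under the partition {{vᵢ : i ∈ S} ∪ {u₁, u₃}, {vᵢ : i ∉ S} ∪ {u₂, u₄}} of the agents of H″, every agent has utility at least W/2, and the minimum utility over all agents equals W/2. -/
/-- The coalition partition induced by a classification function `f`:
the coalition of `x` is the set of agents with the same `f`-value as `x`. -/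
def classPart {A κ : Type*} [Fintype A] [DecidableEq A] [DecidableEq κ] (f : A → κ) :
    A → Finset A := fun x => Finset.univ.filter (fun y => f y = f x)

/-- The weights of the ASHG `H″` associated to positive integers `a₁, …, aₙ` with
`W = Σᵢ aᵢ`: agents are `v₁, …, vₙ` (the `Sum.inl` part) and `u₁, u₂, u₃, u₄`
(the `Sum.inr` part, indexed `0,1,2,3`); `w(vᵢ,u₁) = w(vᵢ,u₂) = aᵢ`,
`w(vᵢ,u₃) = w(vᵢ,u₄) = W/2 − aᵢ`, `w(u₁,u₂) = −2W−1`, and all other weights `0`. -/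
def H''w {n : ℕ} (a : Fin n → ℕ) : Fin n ⊕ Fin 4 → Fin n ⊕ Fin 4 → ℚ := fun x y =>
  let W : ℚ := ∑ t, (a t : ℚ)
  match x, y with
  | Sum.inl i, Sum.inr j => if j = 0 ∨ j = 1 then (a i : ℚ) else W / 2 - (a i : ℚ)
  | Sum.inr j, Sum.inl i => if j = 0 ∨ j = 1 then (a i : ℚ) else W / 2 - (a i : ℚ)
  | Sum.inr p, Sum.inr q => if (p = 0 ∧ q = 1) ∨ (p = 1 ∧ q = 0) then -2 * W - 1 else 0
  | Sum.inl _, Sum.inl _ => 0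

theorem util_classPart {A κ : Type*} [Fintype A] [DecidableEq A] [DecidableEq κ]
    (w : A → A → ℚ) (hw : ∀ x, w x x = 0) (f : A → κ) (x : A) :
    util w (classPart f) x = ∑ y, if f y = f x then w x y else 0 := by
  rw [util, classPart, Finset.sum_erase _ (hw x), Finset.sum_filter]

theorem H''w_self {n : ℕ} (a : Fin n → ℕ) (x : Fin n ⊕ Fin 4) : H''w a x x = 0 := by
  rcases x with i | j
  · rfl
  · fin_cases j <;> simp [H''w]

/-- If numbers below `h ≥ 0` sum to `h`, then their deficits from `h` sum to at least `h`. -/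
theorem le_sum_sub_of_sum_eq {ι : Type*} (a : ι → ℚ) (h : ℚ) (h0 : 0 ≤ h) (ha : ∀ i, a i < h)
    (T : Finset ι) (hT : ∑ i ∈ T, a i = h) : h ≤ ∑ i ∈ T, (h - a i) := by
  rw [Finset.sum_sub_distrib, hT, Finset.sum_const, nsmul_eq_mul]
  rcases Nat.lt_or_ge T.card 2 with hc | hc
  · interval_cases hcard : T.card
    · rw [Finset.card_eq_zero] at hcard
      subst hcard
      simp at hT
      simp [← hT]
    · obtain ⟨i, rfl⟩ := Finset.card_eq_one.mp hcard
      rw [Finset.sum_singleton] at hT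
      exact absurd hT (ha i).ne
  · have hc' : (2 : ℚ) ≤ T.card := by exact_mod_cast hc
    nlinarith

/-- if `S ⊆ {1,…,n}` satisfies `Σ_{i∈S} aᵢ = W/2`, then under the partition
`{{vᵢ : i ∈ S} ∪ {u₁,u₃}, {vᵢ : i ∉ S} ∪ {u₂,u₄}}` of the agents of `H″`, every agent has
utility at least `W/2`, and the minimum utility over all agents equals `W/2`. -/
theorem partition_min_utility_half {n : ℕ} (a : Fin n → ℕ) (hpos : ∀ i, 0 < a i)
    (W : ℚ) (hW : W = ∑ i, (a i : ℚ)) (hsmall : ∀ i, (a i : ℚ) < W / 2)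
    (S : Finset (Fin n)) (hS : ∑ i ∈ S, (a i : ℚ) = W / 2) :
    (∀ x : Fin n ⊕ Fin 4,
        W / 2 ≤ util (H''w a)
          (classPart (Sum.elim (fun i => decide (i ∈ S)) (fun j => decide (j = 0 ∨ j = 2)))) x) ∧
      (∃ x : Fin n ⊕ Fin 4,
        util (H''w a)
          (classPart (Sum.elim (fun i => decide (i ∈ S)) (fun j => decide (j = 0 ∨ j = 2)))) x
          = W / 2) := by
  have hSc : ∑ i ∈ Sᶜ, (a i : ℚ) = W / 2 := by
    have h := Finset.sum_add_sum_compl S (fun i => (a i : ℚ))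
    linarith
  have hcomp (T : Finset (Fin n)) (hT : ∑ i ∈ T, (a i : ℚ) = W / 2) :
      W / 2 ≤ ∑ i ∈ T, (W / 2 - (a i : ℚ)) :=
    le_sum_sub_of_sum_eq _ _ (hS ▸ Finset.sum_nonneg fun i _ => Nat.cast_nonneg (a i)) hsmall T hT
  have hS' := hcomp S hS
  have hSc' := hcomp Sᶜ hSc
  have hu (j : Fin 4) : util (H''w a)
      (classPart (Sum.elim (fun i => decide (i ∈ S)) (fun j => decide (j = 0 ∨ j = 2))))
        (Sum.inr j) =
      ∑ i ∈ if j = 0 ∨ j = 2 then S else Sᶜ,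
        if j = 0 ∨ j = 1 then (a i : ℚ) else W / 2 - a i := by
    rw [util_classPart _ (H''w_self a), Fintype.sum_sum_type, Fin.sum_univ_four,
      ← Finset.sum_filter]
    fin_cases j <;> simp [H''w, ← hW, Finset.filter_notMem_eq_sdiff, Finset.compl_eq_univ_sdiff]
  refine ⟨?_, Sum.inr 0, by rw [hu]; simpa using hS⟩
  rintro (i | j)
  · rw [util_classPart _ (H''w_self a), Fintype.sum_sum_type, Fin.sum_univ_four]
    by_cases hi : i ∈ S <;> simp [H''w, ← hW, hi]
  · rw [hu]
    fin_cases j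
    · simpa using hS.ge
    · simpa using hSc.ge
    · simpa using hS'
    · simpa using hSc'
end

section
/- Let m ≥ 1, let a₁,…,a_{3m} be positive integers, let B be a positive integer with Σᵢ aᵢ = mB and aᵢ < B for every i, and let G′_m be the associated ASHG. Then there is a partition (A₁,…,A_m) of {1,…,3m} with Σ_{i∈A_j} aᵢ = B for every j if and only if G′_m admits a partition under which every agent has utility at least B. -/
/-- The weights of the ASHG `G′_m` associated to positive integers `a₁, …, a_{3m}` with
`Σᵢ aᵢ = mB`: agents are `vᵢ = (i,0)`, `v′ᵢ = (i,1)`, `v″ᵢ = (i,2)` (the `Sum.inl` part) and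
`u₁, …, u_m` (the `Sum.inr` part); `w(vᵢ,u_j) = aᵢ` for all `i, j`, `w(u_p,u_q) = −mB` for
`p ≠ q`, `w(vᵢ,v′ᵢ) = w(vᵢ,v″ᵢ) = B/2 − aᵢ/2`, `w(v′ᵢ,v″ᵢ) = B/2 + aᵢ/2`,
and all other weights `0`. -/
def G'mw {m : ℕ} (a : Fin (3 * m) → ℕ) (B : ℕ) :
    (Fin (3 * m) × Fin 3) ⊕ Fin m → (Fin (3 * m) × Fin 3) ⊕ Fin m → ℚ := fun x y =>
  match x, y with
  | Sum.inl (i, t), Sum.inl (j, r) =>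
      if i = j then
        if (t = 0 ∧ (r = 1 ∨ r = 2)) ∨ ((t = 1 ∨ t = 2) ∧ r = 0) then
          (B : ℚ) / 2 - (a i : ℚ) / 2
        else if (t = 1 ∧ r = 2) ∨ (t = 2 ∧ r = 1) then (B : ℚ) / 2 + (a i : ℚ) / 2
        else 0
      else 0
  | Sum.inl (i, t), Sum.inr _ => if t = 0 then (a i : ℚ) else 0
  | Sum.inr _, Sum.inl (i, t) => if t = 0 then (a i : ℚ) else 0
  | Sum.inr p, Sum.inr q => if p = q then 0 else -(m : ℚ) * (B : ℚ)

theorem util_eq_sum_ite {A : Type*} [Fintype A] [DecidableEq A] (w : A → A → ℚ)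
    (P : A → Finset A) (x : A) (hx : w x x = 0) :
    util w P x = ∑ y, if y ∈ P x then w x y else 0 := by
  rw [util, Finset.sum_erase _ hx, Finset.sum_ite_mem, Finset.univ_inter]

theorem G'mw_self {m : ℕ} (a : Fin (3 * m) → ℕ) (B : ℕ)
    (x : (Fin (3 * m) × Fin 3) ⊕ Fin m) : G'mw a B x x = 0 := by
  rcases x with ⟨i, t⟩ | p
  · fin_cases t <;> simp [G'mw]
  · simp [G'mw]

theorem util_G'mw_inl {m : ℕ} (a : Fin (3 * m) → ℕ) (B : ℕ)
    (P : (Fin (3 * m) × Fin 3) ⊕ Fin m → Finset ((Fin (3 * m) × Fin 3) ⊕ Fin m))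
    (i : Fin (3 * m)) (t : Fin 3) :
    util (G'mw a B) P (Sum.inl (i, t)) =
      (∑ r, if Sum.inl (i, r) ∈ P (Sum.inl (i, t)) then
        G'mw a B (Sum.inl (i, t)) (Sum.inl (i, r)) else 0) +
      ∑ q, if Sum.inr q ∈ P (Sum.inl (i, t)) then (if t = 0 then (a i : ℚ) else 0) else 0 := by
  rw [util_eq_sum_ite _ _ _ (G'mw_self a B _), Fintype.sum_sum_type, Fintype.sum_prod_type]
  congr 1
  refine Fintype.sum_eq_single i fun j hj => Finset.sum_eq_zero fun r _ => ?_
  simp [G'mw, hj.symm]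

theorem util_G'mw_inr {m : ℕ} (a : Fin (3 * m) → ℕ) (B : ℕ)
    (P : (Fin (3 * m) × Fin 3) ⊕ Fin m → Finset ((Fin (3 * m) × Fin 3) ⊕ Fin m)) (p : Fin m) :
    util (G'mw a B) P (Sum.inr p) =
      (∑ i, if Sum.inl (i, 0) ∈ P (Sum.inr p) then (a i : ℚ) else 0) +
      ∑ q, if Sum.inr q ∈ P (Sum.inr p) then
        (if p = q then 0 else -(m : ℚ) * (B : ℚ)) else 0 := by
  rw [util_eq_sum_ite _ _ _ (G'mw_self a B _), Fintype.sum_sum_type, Fintype.sum_prod_type]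
  simp [G'mw, Fin.sum_univ_three]

/-- If a total weight `mB` is split into `m` classes of weight at least `B` each, then every class
has weight exactly `B`. -/
theorem sum_fiber_eq_of_le {ι : Type*} [Fintype ι] {m : ℕ} (a : ι → ℕ) (B : ℕ)
    (hsum : ∑ i, a i = m * B) (f : ι → Fin m)
    (h : ∀ j, B ≤ ∑ i ∈ Finset.univ.filter (fun i => f i = j), a i) (j : Fin m) :
    ∑ i ∈ Finset.univ.filter (fun i => f i = j), a i = B := by
  have htot : ∑ _j : Fin m, B = ∑ j, ∑ i ∈ Finset.univ.filter (fun i => f i = j), a i := by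
    rw [Finset.sum_fiberwise, hsum]
    simp
  exact ((Finset.sum_eq_sum_iff_of_le fun j _ => h j).1 htot j (Finset.mem_univ j)).symm

/-- The coalition structure in which each `u_j` joins all triples assigned to `j`. -/
def coalitionsOfAssignment {m : ℕ} (f : Fin (3 * m) → Fin m)
    (x : (Fin (3 * m) × Fin 3) ⊕ Fin m) : Finset ((Fin (3 * m) × Fin 3) ⊕ Fin m) :=
  Finset.univ.filter fun y =>
    Sum.elim (fun z => f z.1) id y = Sum.elim (fun z => f z.1) id x

theorem mem_coalitionsOfAssignment {m : ℕ} (f : Fin (3 * m) → Fin m)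
    (x y : (Fin (3 * m) × Fin 3) ⊕ Fin m) :
    y ∈ coalitionsOfAssignment f x ↔
      Sum.elim (fun z => f z.1) id y = Sum.elim (fun z => f z.1) id x := by
  simp [coalitionsOfAssignment]

theorem isPartitionFun_coalitionsOfAssignment {m : ℕ} (f : Fin (3 * m) → Fin m) :
    IsPartitionFun (coalitionsOfAssignment f) := by
  refine ⟨fun x => by simp [coalitionsOfAssignment], fun x y h => ?_⟩
  simp only [coalitionsOfAssignment, Finset.mem_filter, Finset.mem_univ, true_and] at h ⊢
  rw [h]

theorem util_coalitionsOfAssignment {m : ℕ} (a : Fin (3 * m) → ℕ) (B : ℕ)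
    (f : Fin (3 * m) → Fin m)
    (hf : ∀ j, ∑ i ∈ Finset.univ.filter (fun i => f i = j), a i = B)
    (x : (Fin (3 * m) × Fin 3) ⊕ Fin m) :
    util (G'mw a B) (coalitionsOfAssignment f) x = B := by
  rcases x with ⟨i, t⟩ | p
  · rw [util_G'mw_inl]
    fin_cases t <;> simp [mem_coalitionsOfAssignment, G'mw, Fin.sum_univ_three] <;> ring
  · rw [util_G'mw_inr]
    simp only [mem_coalitionsOfAssignment, Sum.elim_inl, Sum.elim_inr, id]
    rw [← Finset.sum_filter, ← Nat.cast_sum, hf p, add_eq_left]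
    refine Finset.sum_eq_zero fun q _ => ?_
    split_ifs with h₁ h₂
    · rfl
    · exact absurd h₁.symm h₂
    · rfl

/-- An agent `vᵢ` with utility at least `B` shares its coalition with some `u_q`. -/
theorem exists_inr_mem_of_le_util {m : ℕ} (a : Fin (3 * m) → ℕ) (B : ℕ)
    (P : (Fin (3 * m) × Fin 3) ⊕ Fin m → Finset ((Fin (3 * m) × Fin 3) ⊕ Fin m))
    (i : Fin (3 * m)) (hpos : 0 < a i) (hsmall : a i < B)
    (h : (B : ℚ) ≤ util (G'mw a B) P (Sum.inl (i, 0))) :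
    ∃ q, Sum.inr q ∈ P (Sum.inl (i, 0)) := by
  by_contra! hno
  have hp : (0 : ℚ) < a i := mod_cast hpos
  have hs : (a i : ℚ) < B := mod_cast hsmall
  rw [util_G'mw_inl] at h
  simp only [hno, Fin.sum_univ_three, G'mw] at h
  simp at h
  split_ifs at h <;> linarith

/-- An agent `u_p` with utility at least `B` is the only `u`-agent of its coalition. -/
theorem eq_of_inr_mem_of_le_util {m : ℕ} (a : Fin (3 * m) → ℕ) (B : ℕ) (hB : 0 < B)
    (hsum : ∑ i, a i = m * B)
    (P : (Fin (3 * m) × Fin 3) ⊕ Fin m → Finset ((Fin (3 * m) × Fin 3) ⊕ Fin m))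
    (p q : Fin m) (h : (B : ℚ) ≤ util (G'mw a B) P (Sum.inr p))
    (hq : Sum.inr q ∈ P (Sum.inr p)) : p = q := by
  by_contra hne
  have hB' : (0 : ℚ) < B := mod_cast hB
  have hmB : (0 : ℚ) ≤ (m : ℚ) * B := by positivity
  rw [util_G'mw_inr] at h
  have h₁ : (∑ i, if Sum.inl (i, 0) ∈ P (Sum.inr p) then (a i : ℚ) else 0) ≤ m * B := by
    calc _ ≤ ∑ i, (a i : ℚ) := Finset.sum_le_sum fun i _ => by split_ifs <;> simp
      _ = m * B := mod_cast hsum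
  have h₂ : (∑ q, if Sum.inr q ∈ P (Sum.inr p) then
      (if p = q then 0 else -(m : ℚ) * (B : ℚ)) else 0) ≤ -(m : ℚ) * B := by
    rw [← Finset.add_sum_erase _ _ (Finset.mem_univ q), if_pos hq, if_neg hne]
    refine add_le_of_nonpos_right (Finset.sum_nonpos fun r _ => ?_)
    split_ifs <;> linarith
  linarith

/-- there is a partition `(A₁,…,A_m)` of `{1,…,3m}` with `Σ_{i∈A_j} aᵢ = B`
for every `j` if and only if `G′_m` admits a partition under which every agent has utility
at least `B`. -/
theorem three_partition_iff_feasible {m : ℕ} (hm : 1 ≤ m)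
    (a : Fin (3 * m) → ℕ) (hpos : ∀ i, 0 < a i) (B : ℕ) (hB : 0 < B)
    (hsum : ∑ i, a i = m * B) (hsmall : ∀ i, a i < B) :
    (∃ f : Fin (3 * m) → Fin m,
        ∀ j : Fin m, ∑ i ∈ Finset.univ.filter (fun i => f i = j), a i = B) ↔
      (∃ P : (Fin (3 * m) × Fin 3) ⊕ Fin m → Finset ((Fin (3 * m) × Fin 3) ⊕ Fin m),
        IsPartitionFun P ∧ ∀ x, (B : ℚ) ≤ util (G'mw a B) P x) := by
  constructor
  · rintro ⟨f, hf⟩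
    exact ⟨coalitionsOfAssignment f, isPartitionFun_coalitionsOfAssignment f,
      fun x => (util_coalitionsOfAssignment a B f hf x).ge⟩
  · rintro ⟨P, ⟨hself, hpart⟩, hP⟩
    choose f hf using fun i =>
      exists_inr_mem_of_le_util a B P i (hpos i) (hsmall i) (hP (Sum.inl (i, 0)))
    have huniq := fun p q => eq_of_inr_mem_of_le_util a B hB hsum P p q (hP (Sum.inr p))
    refine ⟨f, sum_fiber_eq_of_le a B hsum f fun j => ?_⟩
    have hmem : ∀ i, Sum.inl (i, 0) ∈ P (Sum.inr j) → f i = j := fun i hi =>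
      (huniq j (f i) (hpart _ _ hi ▸ hf i)).symm
    have h := hP (Sum.inr j)
    rw [util_G'mw_inr] at h
    have hzero : (∑ q, if Sum.inr q ∈ P (Sum.inr j) then
        (if j = q then 0 else -(m : ℚ) * (B : ℚ)) else 0) = 0 :=
      Finset.sum_eq_zero fun q _ => by
        split_ifs with h₁ h₂
        · rfl
        · exact absurd (huniq j q h₁) h₂
        · rfl
    rw [hzero, add_zero] at h
    have hle : (∑ i, if Sum.inl (i, 0) ∈ P (Sum.inr j) then (a i : ℚ) else 0) ≤
        ∑ i, if f i = j then (a i : ℚ) else 0 := by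
      refine Finset.sum_le_sum fun i _ => ?_
      split_ifs with h₁ h₂
      · rfl
      · exact absurd (hmem i h₁) h₂
      · positivity
      · rfl
    have h' := h.trans hle
    rw [← Finset.sum_filter] at h'
    exact_mod_cast h'
end

section
/- In a tree ASHG with self-loops, let u be a leaf with unique neighbor v, and suppose s(u) ≥ W, s(u) + w(u,v) ≥ W, and w(v,u) ≥ 0. Then the instance is feasible for threshold W if and only if the instance on the tree T − u, with the same weights and self-loop values except s′(v) = s(v) + w(v,u), is feasible for threshold W. -/
/-- The utility of agent `x` in a tree ASHG with self-loops: the self-loop value `s x` plus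
the sum of `w x y` over the neighbours `y` (w.r.t. the adjacency `Adj`) of `x` lying in
`x`'s coalition. -/
noncomputable def utilS {A : Type*} [Fintype A] [DecidableEq A] (Adj : A → A → Prop)
    (w : A → A → ℚ) (s : A → ℚ) (P : A → Finset A) (x : A) : ℚ :=
  s x + ∑ y ∈ @Finset.filter _ (fun y => Adj x y) (Classical.decPred _) ((P x).erase x), w x y

/-- Feasibility for threshold `W`: some partition gives every agent utility at least `W`. -/
noncomputable def FeasibleS {A : Type*} [Fintype A] [DecidableEq A] (Adj : A → A → Prop)
    (w : A → A → ℚ) (s : A → ℚ) (W : ℚ) : Prop :=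
  ∃ P : A → Finset A, IsPartitionFun P ∧ ∀ x, W ≤ utilS Adj w s P x

open Classical in
lemma utilS_eq_sum_ite {A : Type*} [Fintype A] [DecidableEq A] {Adj : A → A → Prop}
    (hirr : ∀ x, ¬ Adj x x) (w : A → A → ℚ) (s : A → ℚ) (P : A → Finset A) (x : A) :
    utilS Adj w s P x = s x + ∑ y, if y ∈ P x ∧ Adj x y then w x y else 0 := by
  unfold utilS
  rw [← Finset.sum_filter]
  congr 1
  refine Finset.sum_congr ?_ fun _ _ => rfl
  ext y
  simp only [Finset.mem_filter, Finset.mem_erase, Finset.mem_univ, true_and]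
  exact ⟨fun h => ⟨h.1.2, h.2⟩, fun h => ⟨⟨fun e => hirr x (e ▸ h.2), h.1⟩, h.2⟩⟩

open Classical in
/-- Deleting a vertex `u` removes exactly the contribution of `u` to each other utility. -/
lemma utilS_eq_utilS_subtype_add {V : Type*} [Fintype V] [DecidableEq V] (G : SimpleGraph V)
    (w : V → V → ℚ) (s : V → ℚ) (u : V) (s' : {x : V // x ≠ u} → ℚ)
    (P : V → Finset V) (Q : {x : V // x ≠ u} → Finset {x : V // x ≠ u})
    (hPQ : ∀ x y, y ∈ Q x ↔ y.1 ∈ P x.1) (x : {x : V // x ≠ u}) :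
    utilS G.Adj w s P x.1 =
      utilS (fun x y : {x : V // x ≠ u} => G.Adj x.1 y.1) (fun x y => w x.1 y.1) s' Q x
        - s' x + s x.1 + if u ∈ P x.1 ∧ G.Adj x.1 u then w x.1 u else 0 := by
  rw [utilS_eq_sum_ite (fun x => G.irrefl),
    utilS_eq_sum_ite (Adj := fun x y : {x : V // x ≠ u} => G.Adj x.1 y.1) (fun x => G.irrefl),
    Fintype.sum_eq_add_sum_subtype_ne _ u]
  simp only [hPQ]
  ring

/-- in a tree ASHG with self-loops, if `u` is a leaf with unique neighbour `v`,
`s(u) ≥ W`, `s(u) + w(u,v) ≥ W`, and `w(v,u) ≥ 0`, then the instance is feasible for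
threshold `W` iff the instance on `T − u`, with the same data except
`s′(v) = s(v) + w(v,u)`, is feasible for threshold `W`. -/
theorem leaf_reduction_case_iv {V : Type*} [Fintype V] [DecidableEq V]
    (G : SimpleGraph V) (hT : G.IsTree) (hcard : 2 ≤ Fintype.card V)
    (w : V → V → ℚ) (s : V → ℚ) (W : ℚ) (u v : V)
    (huv : G.Adj u v) (hleaf : ∀ y, G.Adj u y → y = v)
    (h1 : W ≤ s u) (h2 : W ≤ s u + w u v) (h3 : 0 ≤ w v u) :
    FeasibleS G.Adj w s W ↔
      FeasibleS (fun x y : {x : V // x ≠ u} => G.Adj x.1 y.1)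
        (fun x y => w x.1 y.1)
        (fun x => if x.1 = v then s v + w v u else s x.1) W := by
  classical
  constructor
  · rintro ⟨P, ⟨hmem, heq⟩, hW⟩
    refine ⟨fun x => Finset.univ.filter fun y => y.1 ∈ P x.1, ⟨by simp [hmem], ?_⟩, fun x => ?_⟩
    · intro a b hb
      simp only [Finset.mem_filter, Finset.mem_univ, true_and] at hb
      simp only [heq _ _ hb]
    · have hx := hW x.1
      rw [utilS_eq_utilS_subtype_add G w s u
        (fun x => if x.1 = v then s v + w v u else s x.1) P
        (fun x => Finset.univ.filter fun y => y.1 ∈ P x.1) (by simp)] at hx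
      by_cases hxv : x.1 = v
      · simp only [hxv, if_true] at hx
        split_ifs at hx <;> linarith
      · have hadj : ¬ G.Adj x.1 u := fun h => hxv (hleaf _ h.symm)
        simp only [hxv, hadj, and_false, if_false] at hx
        linarith
  · rintro ⟨Q, ⟨hmem, heq⟩, hW⟩
    let f : V → {x : V // x ≠ u} := fun x => if h : x = u then ⟨v, huv.ne'⟩ else ⟨x, h⟩
    have hf : ∀ x : {x : V // x ≠ u}, f x.1 = x := fun x => by simp [f, x.2]
    have hfu : f u = ⟨v, huv.ne'⟩ := by simp [f]
    let P : V → Finset V := fun x => Finset.univ.filter fun y => f y ∈ Q (f x)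
    have hP : ∀ x y, y ∈ P x ↔ f y ∈ Q (f x) := fun x y => by simp [P]
    refine ⟨P, ⟨fun a => (hP a a).2 (hmem _), fun a b hb => ?_⟩, fun x => ?_⟩
    · simp only [P, heq _ _ ((hP a b).1 hb)]
    by_cases hxu : x = u
    · subst hxu
      rw [utilS_eq_sum_ite (fun x => G.irrefl), Finset.sum_eq_single v]
      · split_ifs <;> linarith
      · intro y _ hy
        exact if_neg fun h => hy (hleaf y h.2)
      · simp
    · have hx := hW ⟨x, hxu⟩
      rw [utilS_eq_utilS_subtype_add G w s u
        (fun x => if x.1 = v then s v + w v u else s x.1) P Q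
        (fun x y => by rw [hP, hf, hf]) ⟨x, hxu⟩]
      by_cases hxv : x = v
      · subst hxv
        have hu : u ∈ P x := by
          rw [hP, hfu, hf ⟨x, hxu⟩]
          exact hmem _
        simp only [hu, huv.symm, and_self, if_true]
        linarith
      · have hadj : ¬ G.Adj x u := fun h => hxv (hleaf _ h.symm)
        simp only [hxv, hadj, and_false, if_false]
        linarith
end
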